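/- Let λ > 1 and C₂ > 0. There exists M₀ > 0 depending only on λ and C₂ such that the following holds for all M ≥ M₀. Let K ⊂ ℝ³ be a convex body containing the origin o in its closure that solves the logarithmic Minkowski problem with density f, 1/λ < f < λ. Suppose a John ellipsoid of K (E ⊂ K ⊂ 3^{3/2}E, centered at the center of mass) has principal radii r₁ ≤ r₂ ≤ r₃ in directions e₁, e₂, e₃ with r₂/r₁ > M and 1/C₂ < r₃/r₂ < C₂. Let K' be the orthogonal projection of K onto the e₂e₃-plane and O' the projection of the origin. Then dist(O', ∂K') ≤ r₃/(√M · C₂), where ∂K' is the boundary of K' inside the e₂e₃-plane. -/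

import Mathlib

open MeasureTheory Metric Set Filter
open scoped RealInnerProductSpace ENNReal NNReal Real

noncomputable section

abbrev E3 := EuclideanSpace ℝ (Fin 3)

def unitSphere : Set E3 := Metric.sphere 0 1

def IsConvexBody (K : Set E3) : Prop :=
  Convex ℝ K ∧ IsCompact K ∧ (interior K).Nonempty

def suppFn (K : Set E3) (x : E3) : ℝ := sSup ((fun y => ⟪x, y⟫) '' K)

def outerNormalAt (K : Set E3) (x ν : E3) : Prop :=
  ‖ν‖ = 1 ∧ ∀ z ∈ K, ⟪ν, z - x⟫ ≤ (0:ℝ)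

def gaussPre (K : Set E3) (ω : Set E3) : Set E3 :=
  {x ∈ frontier K | ∃ ν ∈ ω, outerNormalAt K x ν}

def coneOver (G : Set E3) : Set E3 := {y | ∃ x ∈ G, ∃ t ∈ Set.Icc (0:ℝ) 1, y = t • x}

def SolvesLMP (K : Set E3) (f : E3 → ℝ) : Prop :=
  ∀ ω : Set E3, ω ⊆ unitSphere → MeasurableSet ω →
    3 * (volume (coneOver (gaussPre K ω))).toReal = ∫ u in ω, f u ∂(μH[2])

def sphSupNorm (f : E3 → ℝ) : ℝ := sSup {c | ∃ x ∈ unitSphere, c = |f x|}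

def sphHolderSemi (α : ℝ) (f : E3 → ℝ) : ℝ :=
  sSup {c | ∃ x ∈ unitSphere, ∃ y ∈ unitSphere, x ≠ y ∧ c = |f x - f y| / ‖x - y‖ ^ α}

def sphHolderNorm (α : ℝ) (f : E3 → ℝ) : ℝ := sphSupNorm f + sphHolderSemi α f

def IsEllipsoid (E : Set E3) (c : E3) (e : Fin 3 → E3) (r : Fin 3 → ℝ) : Prop :=
  (∀ i, 0 < r i) ∧ Orthonormal ℝ e ∧
  E = {x : E3 | (∑ i, (⟪x - c, e i⟫ / r i) ^ 2) ≤ 1}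

def dilate (c : E3) (s : ℝ) (A : Set E3) : Set E3 := (fun x => c + s • (x - c)) '' A

def centerOfMass (K : Set E3) : E3 := ((volume K).toReal)⁻¹ • ∫ x in K, x

/-- `E ⊆ K ⊆ 3^{3/2} E`, the dilation taken about the center `c` of `E`. -/
def IsJohnEllipsoid (K E : Set E3) (c : E3) : Prop :=
  E ⊆ K ∧ K ⊆ dilate c ((3:ℝ) ^ ((3:ℝ) / 2)) E

/-- Orthogonal projection onto the plane spanned by `e 1` and `e 2` (the `e₂e₃`-plane). -/
def projPlane (e : Fin 3 → E3) (x : E3) : E3 := ⟪x, e 1⟫ • e 1 + ⟪x, e 2⟫ • e 2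

set_option linter.unusedSimpArgs false

section Helpers

variable (b : OrthonormalBasis (Fin 3) ℝ E3)

lemma aux_expand (x : E3) : x = ⟪x, b 0⟫ • b 0 + ⟪x, b 1⟫ • b 1 + ⟪x, b 2⟫ • b 2 := by
  conv_lhs => rw [← b.sum_repr' x]
  simp [Fin.sum_univ_three, real_inner_comm]

lemma aux_normsq (x : E3) : ‖x‖ ^ 2 = ⟪x, b 0⟫ ^ 2 + ⟪x, b 1⟫ ^ 2 + ⟪x, b 2⟫ ^ 2 := by
  rw [← b.sum_sq_norm_inner_left x]
  simp [Fin.sum_univ_three]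

lemma aux_inner (i j : Fin 3) : ⟪b i, b j⟫ = if i = j then (1:ℝ) else 0 :=
  (orthonormal_iff_ite.mp b.orthonormal) i j

lemma aux_p0 (x : E3) : ⟪projPlane b x, b 0⟫ = (0:ℝ) := by
  simp [projPlane, inner_add_left, real_inner_smul_left, aux_inner]

lemma aux_p1 (x : E3) : ⟪projPlane b x, b 1⟫ = (⟪x, b 1⟫ : ℝ) := by
  simp [projPlane, inner_add_left, real_inner_smul_left, aux_inner]

lemma aux_p2 (x : E3) : ⟪projPlane b x, b 2⟫ = (⟪x, b 2⟫ : ℝ) := by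
  simp [projPlane, inner_add_left, real_inner_smul_left, aux_inner]

lemma aux_pnormsq (x : E3) : ‖projPlane b x‖ ^ 2 = ⟪x, b 1⟫ ^ 2 + ⟪x, b 2⟫ ^ 2 := by
  rw [aux_normsq b, aux_p0, aux_p1, aux_p2]; ring

/-- the double cap around `± b 0` -/
def dcap (t : ℝ) : Set E3 := {u | u ∈ unitSphere ∧ ⟪u, b 1⟫ ^ 2 + ⟪u, b 2⟫ ^ 2 ≤ t ^ 2}

def rotA (φ : ℝ) (u : E3) : E3 :=
  (Real.cos φ * ⟪u, b 0⟫ - Real.sin φ * ⟪u, b 1⟫) • b 0 +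
  (Real.sin φ * ⟪u, b 0⟫ + Real.cos φ * ⟪u, b 1⟫) • b 1 + ⟪u, b 2⟫ • b 2

lemma rotA_0 (φ : ℝ) (u : E3) : ⟪rotA b φ u, b 0⟫ =
    Real.cos φ * ⟪u, b 0⟫ - Real.sin φ * ⟪u, b 1⟫ := by
  simp [rotA, inner_add_left, real_inner_smul_left, aux_inner]

lemma rotA_1 (φ : ℝ) (u : E3) : ⟪rotA b φ u, b 1⟫ =
    Real.sin φ * ⟪u, b 0⟫ + Real.cos φ * ⟪u, b 1⟫ := by
  simp [rotA, inner_add_left, real_inner_smul_left, aux_inner]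

lemma rotA_2 (φ : ℝ) (u : E3) : ⟪rotA b φ u, b 2⟫ = (⟪u, b 2⟫ : ℝ) := by
  simp [rotA, inner_add_left, real_inner_smul_left, aux_inner]

lemma rotA_norm (φ : ℝ) (u : E3) : ‖rotA b φ u‖ = ‖u‖ := by
  have : ‖rotA b φ u‖ ^ 2 = ‖u‖ ^ 2 := by
    rw [aux_normsq b, rotA_0, rotA_1, rotA_2, aux_normsq b u]
    have := Real.sin_sq_add_cos_sq φ
    linear_combination (⟪u, b 0⟫ ^ 2 + ⟪u, b 1⟫ ^ 2) * this
  exact (sq_eq_sq₀ (norm_nonneg _) (norm_nonneg _)).mp this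

lemma rotA_isometry (φ : ℝ) : Isometry (rotA b φ) := by
  apply Isometry.of_dist_eq
  intro x y
  rw [dist_eq_norm, dist_eq_norm, ← rotA_norm b φ (x - y)]
  congr 1
  simp only [rotA, inner_sub_left]
  module

lemma dcap_compact (t : ℝ) : IsCompact (dcap b t) := by
  have h1 : IsCompact unitSphere := isCompact_sphere _ _
  refine h1.of_isClosed_subset ?_ (fun u hu => hu.1)
  apply IsClosed.inter
  · exact h1.isClosed
  · have hcon : Continuous fun u : E3 => (⟪u, b 1⟫ ^ 2 + ⟪u, b 2⟫ ^ 2 : ℝ) := by fun_prop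
    exact isClosed_le hcon continuous_const

lemma packing (t : ℝ) (k : ℕ) (ht0 : 0 < t) (ht : t ^ 2 ≤ 1 / 2) (hk : (k:ℝ) * (9 * t) ≤ 1) :
    (k : ℝ≥0∞) * μH[2] (dcap b t) ≤ μH[2] unitSphere := by
  have hdisj : ∀ i j : ℕ, i < j → j < k → Disjoint (rotA b (i * (9 * t)) '' dcap b t)
      (rotA b (j * (9 * t)) '' dcap b t) := by
    intro i j hij hjk
    rw [Set.disjoint_left]
    rintro _ ⟨u, hu, rfl⟩ ⟨w, hw, huw⟩
    set φ : ℝ := i * (9 * t)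
    set ψ : ℝ := j * (9 * t)
    have hd1 : 9 * t ≤ ψ - φ := by
      have : (i:ℝ) + 1 ≤ j := by exact_mod_cast hij
      simp only [φ, ψ]; nlinarith
    have hd2 : ψ - φ ≤ 1 := by
      have : (j:ℝ) ≤ k := by exact_mod_cast hjk.le
      have h0 : (0:ℝ) ≤ i := by positivity
      simp only [φ, ψ]; nlinarith
    have hsin : 4 * t < Real.sin (ψ - φ) := by
      have := Real.mul_le_sin (x := ψ - φ) (by linarith) (by linarith [Real.pi_gt_three])
      have h2 : (1/2:ℝ) ≤ 2 / π := by
        rw [div_le_div_iff₀ (by norm_num) Real.pi_pos]; linarith [Real.pi_le_four]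
      nlinarith
    have e0 := congrArg (fun x => (⟪x, b 0⟫ : ℝ)) huw
    have e1 := congrArg (fun x => (⟪x, b 1⟫ : ℝ)) huw
    simp only [rotA_0, rotA_1] at e0 e1
    have key : ⟪w, b 1⟫ = Real.cos (ψ - φ) * ⟪u, b 1⟫ - Real.sin (ψ - φ) * ⟪u, b 0⟫ := by
      rw [Real.cos_sub, Real.sin_sub]
      have := Real.sin_sq_add_cos_sq ψ
      linear_combination (-Real.sin ψ) * e0 + Real.cos ψ * e1 - ⟪w, b 1⟫ * this
    have hu1 : |(⟪u, b 1⟫:ℝ)| ≤ t := abs_le_of_sq_le_sq (by nlinarith [hu.2, sq_nonneg (⟪u, b 2⟫:ℝ)]) ht0.le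
    have hw1 : |(⟪w, b 1⟫:ℝ)| ≤ t := abs_le_of_sq_le_sq (by nlinarith [hw.2, sq_nonneg (⟪w, b 2⟫:ℝ)]) ht0.le
    have hun : ‖u‖ = 1 := by simpa [unitSphere] using hu.1
    have hu0 : (1/2:ℝ) ≤ |(⟪u, b 0⟫:ℝ)| := by
      have := aux_normsq b u
      rw [hun] at this
      refine (pow_le_pow_iff_left₀ (by norm_num) (abs_nonneg _) two_ne_zero).mp ?_
      rw [sq_abs]
      nlinarith [hu.2]
    have hc : |Real.cos (ψ - φ) * (⟪u, b 1⟫:ℝ)| ≤ t := by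
      rw [abs_mul]
      calc _ ≤ 1 * t := mul_le_mul (Real.abs_cos_le_one _) hu1 (abs_nonneg _) zero_le_one
        _ = t := one_mul t
    have hs : |Real.sin (ψ - φ) * (⟪u, b 0⟫:ℝ)| ≤ 2 * t := by
      have : Real.sin (ψ - φ) * (⟪u, b 0⟫:ℝ) = Real.cos (ψ - φ) * ⟪u, b 1⟫ - ⟪w, b 1⟫ := by
        linarith
      rw [this]
      exact (abs_sub _ _).trans (by linarith)
    rw [abs_mul, abs_of_pos (by linarith : 0 < Real.sin (ψ - φ))] at hs
    nlinarith
  have hun : μH[2] (⋃ j ∈ Finset.range k, rotA b (j * (9 * t)) '' dcap b t)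
      = ∑ j ∈ Finset.range k, μH[2] (rotA b (j * (9 * t)) '' dcap b t) := by
    apply measure_biUnion_finset
    · intro i hi j hj hij
      simp only [Finset.coe_range, Set.mem_Iio] at hi hj
      rcases lt_or_gt_of_ne hij with h | h
      · exact hdisj i j h hj
      · exact (hdisj j i h hi).symm
    · intro j _
      exact ((dcap_compact b t).image (rotA_isometry b _).continuous).measurableSet
  have : ∑ j ∈ Finset.range k, μH[2] (rotA b (j * (9 * t)) '' dcap b t)
      = (k : ℝ≥0∞) * μH[2] (dcap b t) := by
    simp only [(rotA_isometry b _).hausdorffMeasure_image (Or.inl (by norm_num : (0:ℝ) ≤ 2))]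
    simp
  rw [← this, ← hun]
  apply measure_mono
  intro x hx
  simp only [Set.mem_iUnion] at hx
  obtain ⟨j, _, u, hu, rfl⟩ := hx
  have hun : ‖u‖ = 1 := by simpa [unitSphere] using hu.1
  simp [unitSphere, rotA_norm, hun]



lemma exists_exit {K : Set E3} (hc : IsCompact K) {y : E3} (hy : y ∈ K)
    (hy0 : y ≠ 0) : ∃ τ : ℝ, 1 ≤ τ ∧ τ • y ∈ K ∧ τ • y ∈ frontier K := by
  let T : Set ℝ := {τ | 1 ≤ τ ∧ τ • y ∈ K}
  have hTne : T.Nonempty := ⟨1, le_refl _, by simpa using hy⟩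
  have hTcl : IsClosed T := by
    apply IsClosed.inter isClosed_Ici
    exact hc.isClosed.preimage (by fun_prop : Continuous fun τ : ℝ => τ • y)
  obtain ⟨R, hR⟩ := hc.isBounded.exists_norm_le
  have hyp : 0 < ‖y‖ := norm_pos_iff.mpr hy0
  have hTb : BddAbove T := by
    refine ⟨R / ‖y‖, ?_⟩
    rintro τ ⟨h1, h2⟩
    have := hR _ h2
    rw [norm_smul, Real.norm_eq_abs, abs_of_nonneg (by linarith)] at this
    rwa [le_div_iff₀ hyp]
  have hmem := hTcl.csSup_mem hTne hTb
  refine ⟨sSup T, hmem.1, hmem.2, ?_⟩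
  refine ⟨subset_closure hmem.2, ?_⟩
  intro hint
  have hcont : Continuous fun τ : ℝ => τ • y := by fun_prop
  have : ∀ᶠ τ in nhds (sSup T), τ • y ∈ interior K :=
    hcont.continuousAt.eventually (isOpen_interior.mem_nhds hint)
  obtain ⟨ε, hε, hb⟩ := Metric.eventually_nhds_iff.mp this
  have h1 := hb (y := sSup T + ε / 2) (by
    rw [Real.dist_eq, add_sub_cancel_left, abs_of_pos (by linarith)]; linarith)
  have := le_csSup hTb (⟨by linarith [hmem.1], interior_subset h1⟩ : sSup T + ε / 2 ∈ T)
  linarith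

lemma exists_normal {K : Set E3} (hK : IsConvexBody K) {x : E3} (hx : x ∈ frontier K) :
    ∃ ν, outerNormalAt K x ν := by
  obtain ⟨hconv, hcomp, hne⟩ := hK
  obtain ⟨g, hg⟩ := geometric_hahn_banach_open_point hconv.interior isOpen_interior hx.2
  have hle : ∀ z ∈ K, g z ≤ g x := by
    intro z hz
    have hz' : z ∈ closure (interior K) := by
      rw [hconv.closure_interior_eq_closure_of_nonempty_interior hne]
      exact subset_closure hz
    exact closure_minimal (fun a ha => (hg a ha).le)
      (isClosed_le g.continuous continuous_const) hz'
  set n := (InnerProductSpace.toDual ℝ E3).symm g with hn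
  have hgn : ∀ z, g z = ⟪n, z⟫ := fun z => by
    rw [hn, InnerProductSpace.toDual_symm_apply]
  have hn0 : n ≠ 0 := by
    intro h
    obtain ⟨a, ha⟩ := hne
    have := hg a ha
    rw [hgn, hgn, h] at this
    simp at this
  have hnp : 0 < ‖n‖ := norm_pos_iff.mpr hn0
  refine ⟨(‖n‖)⁻¹ • n, ?_, ?_⟩
  · rw [norm_smul, norm_inv, norm_norm, inv_mul_cancel₀ hnp.ne']
  · intro z hz
    rw [real_inner_smul_left, inner_sub_right, ← hgn, ← hgn]
    have := hle z hz
    have h2 : 0 < (‖n‖)⁻¹ := inv_pos.mpr hnp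
    nlinarith

lemma frontier_hit {S : Set E3} {a : E3} (h0 : (0:E3) ∈ S) (ha : a ∈ S) {δ : ℝ} (hδ : 0 ≤ δ)
    (h : (-δ) • a ∉ S) : Metric.infDist 0 (intrinsicFrontier ℝ S) ≤ δ * ‖a‖ := by
  let P : ℝ → affineSpan ℝ S := fun τ => ⟨AffineMap.lineMap (0:E3) a (-((max 0 (min τ 1)) * δ)),
    AffineMap.lineMap_mem _ (subset_affineSpan ℝ S h0) (subset_affineSpan ℝ S ha)⟩
  have hPv : ∀ τ, (P τ : E3) = (-((max 0 (min τ 1)) * δ)) • a := fun τ => by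
    simp [P, AffineMap.lineMap_apply]
  have hPc : Continuous P := by
    apply Continuous.subtype_mk
    simp only [AffineMap.lineMap_apply]
    fun_prop
  let T : Set ℝ := P ⁻¹' ((↑) ⁻¹' S)
  have hT0 : (0:ℝ) ∈ T := by simp [T, hPv, h0]
  have hT1 : (1:ℝ) ∉ T := by
    simpa [T, hPv] using h
  obtain ⟨τ, hf⟩ : (frontier T).Nonempty :=
    nonempty_frontier_iff.mpr ⟨⟨0, hT0⟩, fun hu => hT1 (hu ▸ Set.mem_univ _)⟩
  have hfr := hPc.frontier_preimage_subset _ hf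
  have hmem : (P τ : E3) ∈ intrinsicFrontier ℝ S := ⟨P τ, hfr, rfl⟩
  refine (Metric.infDist_le_dist_of_mem hmem).trans ?_
  have hq0 : 0 ≤ max 0 (min τ 1) := le_max_left _ _
  have hq1 : max 0 (min τ 1) ≤ 1 := max_le zero_le_one (min_le_right _ _)
  rw [hPv, dist_zero_left, norm_smul, Real.norm_eq_abs, abs_neg,
    abs_of_nonneg (mul_nonneg hq0 hδ)]
  have h3 : max 0 (min τ 1) * δ ≤ δ := by nlinarith
  exact mul_le_mul_of_nonneg_right h3 (norm_nonneg _)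

end Helpers

section Body

variable (b : OrthonormalBasis (Fin 3) ℝ E3) (r : Fin 3 → ℝ)

def Qh (v : E3) : ℝ := (⟪v, b 1⟫ / r 1) ^ 2 + (⟪v, b 2⟫ / r 2) ^ 2

def Qf (v : E3) : ℝ := (⟪v, b 0⟫ / r 0) ^ 2 + Qh b r v

lemma Qh_nonneg (v : E3) : 0 ≤ Qh b r v := by unfold Qh; positivity

lemma Qh_p (v : E3) : Qh b r (projPlane b v) = Qh b r v := by
  unfold Qh; rw [aux_p1, aux_p2]

lemma Qh_smul (s : ℝ) (v : E3) : Qh b r (s • v) = s ^ 2 * Qh b r v := by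
  unfold Qh; simp only [real_inner_smul_left]; ring

lemma Qf_smul (s : ℝ) (v : E3) : Qf b r (s • v) = s ^ 2 * Qf b r v := by
  unfold Qf; rw [Qh_smul]; simp only [real_inner_smul_left]; ring

lemma Qh_neg (v : E3) : Qh b r (-v) = Qh b r v := by
  unfold Qh; simp only [inner_neg_left]; ring

lemma Qh_add_le (v w : E3) : Qh b r (v + w) ≤ 2 * Qh b r v + 2 * Qh b r w := by
  unfold Qh; simp only [inner_add_left, add_div]
  nlinarith [sq_nonneg ((⟪v, b 1⟫:ℝ) / r 1 - ⟪w, b 1⟫ / r 1),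
    sq_nonneg ((⟪v, b 2⟫:ℝ) / r 2 - ⟪w, b 2⟫ / r 2)]

lemma Qh_le_Qf (v : E3) : Qh b r v ≤ Qf b r v := by
  unfold Qf; nlinarith [sq_nonneg ((⟪v, b 0⟫:ℝ) / r 0)]

lemma Qh_b0 (s : ℝ) (v : E3) : Qh b r (v + s • b 0) = Qh b r v := by
  unfold Qh; simp [inner_add_left, real_inner_smul_left, aux_inner]

variable {b r}

lemma abs0_le (hr : ∀ i, 0 < r i) {v : E3} (h : Qf b r v ≤ 27) : |(⟪v, b 0⟫:ℝ)| ≤ 6 * r 0 := by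
  have h0 := hr 0
  have h1 := Qh_nonneg b r v
  have : ((⟪v, b 0⟫:ℝ) / r 0) ^ 2 ≤ 6 ^ 2 := by unfold Qf at h; linarith
  have := abs_le_of_sq_le_sq this (by norm_num)
  rwa [abs_div, abs_of_pos h0, div_le_iff₀ h0] at this

lemma slant (hr : ∀ i, 0 < r i) (h12 : r 1 ≤ r 2) {K : Set E3} {c : E3}
    (hin : ∀ v, Qf b r v ≤ 1 → c + v ∈ K) (hout : ∀ x ∈ K, Qf b r (x - c) ≤ 27)
    {x ν : E3} (hx : x ∈ K) (hq : Qh b r (x - c) ≤ 1 / 4) (hν : outerNormalAt K x ν) :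
    ‖projPlane b ν‖ ≤ 12 * (r 0 / r 1) := by
  have h1 := hr 1
  have h2 := hr 2
  have h0 := hr 0
  by_cases hp : ‖projPlane b ν‖ = 0
  · rw [hp]; positivity
  have hpp : 0 < ‖projPlane b ν‖ := lt_of_le_of_ne (norm_nonneg _) (Ne.symm hp)
  set s : ℝ := r 1 / 2 / ‖projPlane b ν‖ with hs
  have hsp : s * ‖projPlane b ν‖ = r 1 / 2 := by rw [hs]; field_simp
  set w : E3 := projPlane b (x - c) + s • projPlane b ν with hw
  have hns : Qh b r (s • projPlane b ν) ≤ 1 / 4 := by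
    have hnn : ‖s • projPlane b ν‖ ^ 2 = (r 1 / 2) ^ 2 := by
      rw [norm_smul, mul_pow, Real.norm_eq_abs, sq_abs, ← mul_pow, hsp]
    rw [aux_normsq b] at hnn
    have e0 : (⟪s • projPlane b ν, b 0⟫ : ℝ) = 0 := by
      rw [real_inner_smul_left, aux_p0, mul_zero]
    rw [e0] at hnn
    unfold Qh
    set A := (⟪s • projPlane b ν, b 1⟫ : ℝ)
    set B := (⟪s • projPlane b ν, b 2⟫ : ℝ)
    have hB : (B / r 2) ^ 2 ≤ (B / r 1) ^ 2 := by
      rw [div_pow, div_pow]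
      exact div_le_div_of_nonneg_left (sq_nonneg _) (by positivity) (by gcongr)
    have : (A / r 1) ^ 2 + (B / r 1) ^ 2 = 1 / 4 := by
      rw [div_pow, div_pow, ← add_div]
      rw [div_eq_iff (by positivity)]
      linarith
    linarith
  have hQw : Qf b r w ≤ 1 := by
    have e0 : (⟪w, b 0⟫ : ℝ) = 0 := by
      rw [hw, inner_add_left, real_inner_smul_left, aux_p0, aux_p0]; ring
    have : Qh b r w ≤ 1 := by
      have := Qh_add_le b r (projPlane b (x - c)) (s • projPlane b ν)
      rw [Qh_p] at this
      linarith
    unfold Qf; rw [e0]; simpa using this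
  have hz := hν.2 _ (hin w hQw)
  have hdec : c + w - x = s • projPlane b ν - (⟪x - c, b 0⟫:ℝ) • b 0 := by
    have := aux_expand b (x - c)
    rw [hw, ← sub_eq_zero]
    have h3 : projPlane b (x - c) = (x - c) - (⟪x - c, b 0⟫:ℝ) • b 0 := by
      rw [eq_sub_iff_add_eq]; unfold projPlane; nth_rw 4 [this]; abel
    rw [h3]; abel
  rw [hdec, inner_sub_right, real_inner_smul_right, real_inner_smul_right] at hz
  have hpin : ⟪ν, projPlane b ν⟫ = ‖projPlane b ν‖ ^ 2 := by
    rw [aux_pnormsq]; unfold projPlane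
    rw [inner_add_right, real_inner_smul_right, real_inner_smul_right]; ring
  rw [hpin] at hz
  have hb0 : |(⟪ν, b 0⟫:ℝ)| ≤ 1 := by
    have := abs_real_inner_le_norm ν (b 0)
    rwa [hν.1, b.norm_eq_one, one_mul] at this
  have ha := abs0_le hr (hout x hx)
  have hprod : (⟪x - c, b 0⟫:ℝ) * ⟪ν, b 0⟫ ≤ 6 * r 0 := by
    refine (le_abs_self _).trans ?_
    rw [abs_mul]
    calc _ ≤ (6 * r 0) * 1 := mul_le_mul ha hb0 (abs_nonneg _) (by positivity)
      _ = _ := mul_one _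
  have : r 1 / 2 * ‖projPlane b ν‖ ≤ 6 * r 0 := by
    rw [← hsp]; nlinarith
  rw [← mul_div_assoc, le_div_iff₀ h1]
  linarith

lemma chord (hr : ∀ i, 0 < r i) (h12 : r 1 ≤ r 2) {K : Set E3} {c : E3} (hconv : Convex ℝ K)
    (h0 : (0:E3) ∈ K)
    (hin : ∀ v, Qf b r v ≤ 1 → c + v ∈ K) (hout : ∀ x ∈ K, Qf b r (x - c) ≤ 27)
    {δ : ℝ} (hδ : 0 < δ) (hδ1 : δ ≤ 1)
    (hd : δ * (6 * r 2) < Metric.infDist 0 (intrinsicFrontier ℝ (projPlane b '' K))) :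
    ∃ α : ℝ, |α| = δ * r 0 / 2 ∧ α • b 0 ∈ K := by
  have hr0 := hr 0
  have hr1 := hr 1
  have hr2 := hr 2
  have hcK : c ∈ K := by simpa using hin 0 (by simp [Qf, Qh])
  have hp0 : projPlane b 0 = 0 := by simp [projPlane]
  have hpc : ‖projPlane b c‖ ≤ 6 * r 2 := by
    have h1 := hout 0 h0
    have h2 := (Qh_le_Qf b r _).trans h1
    rw [zero_sub, Qh_neg] at h2
    unfold Qh at h2
    have hA : (⟪c, b 1⟫ / r 2 : ℝ) ^ 2 ≤ (⟪c, b 1⟫ / r 1) ^ 2 := by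
      rw [div_pow, div_pow]
      exact div_le_div_of_nonneg_left (sq_nonneg _) (by positivity) (by gcongr)
    have : (⟪c, b 1⟫ / r 2 : ℝ) ^ 2 + (⟪c, b 2⟫ / r 2) ^ 2 ≤ 27 := by linarith
    rw [div_pow, div_pow, ← add_div, ← aux_pnormsq, div_le_iff₀ (by positivity)] at this
    refine (pow_le_pow_iff_left₀ (norm_nonneg _) (by positivity) two_ne_zero).mp ?_
    nlinarith
  have hmem : (-δ) • projPlane b c ∈ projPlane b '' K := by
    by_contra hcon
    have := frontier_hit (S := projPlane b '' K) ⟨0, h0, hp0⟩ ⟨c, hcK, rfl⟩ hδ.le hcon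
    nlinarith
  obtain ⟨q, hqK, hq⟩ := hmem
  have hq1 : (⟪q, b 1⟫:ℝ) = -δ * ⟪c, b 1⟫ := by
    rw [← aux_p1, hq, real_inner_smul_left, aux_p1]
  have hq2 : (⟪q, b 2⟫:ℝ) = -δ * ⟪c, b 2⟫ := by
    rw [← aux_p2, hq, real_inner_smul_left, aux_p2]
  have hE : ∀ σ : ℝ, σ ^ 2 = 1 → c + (σ * r 0) • b 0 ∈ K := by
    intro σ hσ
    apply hin
    unfold Qf Qh
    simp [real_inner_smul_left, aux_inner]
    rw [mul_div_assoc, div_self hr0.ne', mul_one, ← sq_abs] at *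
    simpa using hσ.le
  have hpt : ∀ σ : ℝ, σ ^ 2 = 1 →
      ((⟪q, b 0⟫ + δ * ⟪c, b 0⟫ + δ * (σ * r 0)) / (1 + δ)) • b 0 ∈ K := by
    intro σ hσ
    have := hconv hqK (hE σ hσ) (a := 1 / (1 + δ)) (b := δ / (1 + δ)) (by positivity)
      (by positivity) (by field_simp)
    convert this using 1
    have hq' := aux_expand b q
    have hc' := aux_expand b c
    rw [hq1, hq2] at hq'
    generalize (⟪q, b 0⟫:ℝ) = q0 at *
    generalize (⟪c, b 0⟫:ℝ) = c0 at *
    generalize (⟪c, b 1⟫:ℝ) = c1 at *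
    generalize (⟪c, b 2⟫:ℝ) = c2 at *
    rw [hq', hc']
    have hne : (1 + δ) ≠ 0 := by positivity
    match_scalars <;> field_simp <;> ring
  have hP := hpt 1 (by norm_num)
  have hN := hpt (-1) (by norm_num)
  set a1 := (⟪q, b 0⟫ + δ * ⟪c, b 0⟫ + δ * (1 * r 0)) / (1 + δ) with ha1
  set a2 := (⟪q, b 0⟫ + δ * ⟪c, b 0⟫ + δ * (-1 * r 0)) / (1 + δ) with ha2
  have hdiff : a1 - a2 = 2 * (δ * r 0 / (1 + δ)) := by
    rw [ha1, ha2]; field_simp; ring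
  have hlow : δ * r 0 / 2 ≤ δ * r 0 / (1 + δ) :=
    div_le_div_of_nonneg_left (by positivity) (by positivity) (by linarith)
  have hshrink : ∀ a : ℝ, a • b 0 ∈ K → δ * r 0 / 2 ≤ |a| →
      ∃ α : ℝ, |α| = δ * r 0 / 2 ∧ α • b 0 ∈ K := by
    intro a ha hle
    have hpos : 0 < δ * r 0 / 2 := by positivity
    have hapos : 0 < |a| := lt_of_lt_of_le hpos hle
    refine ⟨(δ * r 0 / 2 / |a|) * a, ?_, ?_⟩
    · rw [abs_mul, abs_div, abs_abs, abs_of_pos hpos]; field_simp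
    · rw [mul_smul]
      exact hconv.smul_mem_of_zero_mem h0 ha
        ⟨by positivity, by rw [div_le_one hapos]; exact hle⟩
  rcases le_total 0 (a1 + a2) with h | h
  · refine hshrink a1 hP (le_trans ?_ (le_abs_self _)); linarith
  · refine hshrink a2 hN (le_trans ?_ (neg_le_abs _)); linarith

/-- The central part of `K`. -/
def Zset (b : OrthonormalBasis (Fin 3) ℝ E3) (r : Fin 3 → ℝ) (K : Set E3) (c : E3) : Set E3 :=
  {y ∈ K | Qh b r (y - c) ≤ 1 / 16}

/-- The part of `Zset` close to the top. -/
def Yset (b : OrthonormalBasis (Fin 3) ℝ E3) (r : Fin 3 → ℝ) (K : Set E3) (c : E3) (β : ℝ) :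
    Set E3 :=
  {y ∈ Zset b r K c | y + β • b 0 ∉ K}

lemma Y_sub_cone (hr : ∀ i, 0 < r i) (h12 : r 1 ≤ r 2) {K : Set E3} {c : E3}
    (hK : IsConvexBody K) (h0 : (0:E3) ∈ K)
    (hin : ∀ v, Qf b r v ≤ 1 → c + v ∈ K) (hout : ∀ x ∈ K, Qf b r (x - c) ≤ 27)
    {α t : ℝ} (hα : α • b 0 ∈ K) (ht : 12 * (r 0 / r 1) ≤ t) :
    Yset b r K c (α / 50) ⊆ coneOver (gaussPre K (dcap b t)) := by
  rintro y ⟨⟨hyK, hyq⟩, hyt⟩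
  have hconv := hK.1
  have hy0 : y ≠ 0 := by
    rintro rfl
    apply hyt
    have := hconv.smul_mem_of_zero_mem h0 hα (t := 1 / 50) ⟨by norm_num, by norm_num⟩
    rw [smul_smul] at this
    convert this using 1
    rw [zero_add]; congr 1; ring
  obtain ⟨τ, hτ1, hτK, hτf⟩ := exists_exit hK.2.1 hyK hy0
  have hτ0 : 0 < τ := by linarith
  have hτ2 : τ < 50 / 49 := by
    by_contra hcon
    push Not at hcon
    have hc1 := hconv hτK hα (a := 1 / τ) (b := 1 - 1 / τ) (by positivity)
      (by rw [sub_nonneg, div_le_one hτ0]; exact hτ1) (by ring)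
    have e1 : (1 / τ) • τ • y + (1 - 1 / τ) • α • b 0 = y + (1 - 1 / τ) • α • b 0 := by
      rw [smul_smul, one_div, inv_mul_cancel₀ hτ0.ne', one_smul]
    rw [e1] at hc1
    have h50 : 1 / 50 ≤ 1 - 1 / τ := by
      have : 1 / τ ≤ 49 / 50 := by
        rw [div_le_div_iff₀ hτ0 (by norm_num)]; linarith
      linarith
    have hpos : 0 < 1 - 1 / τ := by linarith
    have := hconv hyK hc1 (a := 1 - (1 / 50) / (1 - 1 / τ)) (b := (1 / 50) / (1 - 1 / τ))
      (by rw [sub_nonneg, div_le_one hpos]; exact h50) (by positivity) (by ring)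
    apply hyt
    convert this using 1
    rw [smul_add, smul_smul, smul_smul, div_mul_cancel₀ _ hpos.ne']
    module
  have hq : Qh b r (τ • y - c) ≤ 1 / 4 := by
    have e : τ • y - c = τ • (y - c) + (τ - 1) • c := by module
    rw [e]
    refine (Qh_add_le b r _ _).trans ?_
    rw [Qh_smul, Qh_smul]
    have hc27 : Qh b r c ≤ 27 := by
      have := (Qh_le_Qf b r _).trans (hout 0 h0)
      rwa [zero_sub, Qh_neg] at this
    have hs1 : τ ^ 2 ≤ (50 / 49) ^ 2 := by gcongr
    have hs2 : (τ - 1) ^ 2 ≤ (1 / 49) ^ 2 := by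
      apply pow_le_pow_left₀ <;> linarith
    have m1 : τ ^ 2 * Qh b r (y - c) ≤ (50 / 49) ^ 2 * (1 / 16) :=
      mul_le_mul hs1 hyq (Qh_nonneg b r _) (by positivity)
    have m2 : (τ - 1) ^ 2 * Qh b r c ≤ (1 / 49) ^ 2 * 27 :=
      mul_le_mul hs2 hc27 (Qh_nonneg b r _) (by positivity)
    norm_num at m1 m2 ⊢
    linarith
  obtain ⟨ν, hν⟩ := exists_normal hK hτf
  have hsl := (slant hr h12 hin hout hτK hq hν).trans ht
  refine ⟨τ • y, ⟨hτf, ν, ⟨?_, ?_⟩, hν⟩, 1 / τ, ⟨by positivity, ?_⟩, ?_⟩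
  · simpa [unitSphere] using hν.1
  · rw [← aux_pnormsq]
    exact pow_le_pow_left₀ (norm_nonneg _) hsl 2
  · rw [div_le_one hτ0]; exact hτ1
  · rw [smul_smul, one_div, inv_mul_cancel₀ hτ0.ne', one_smul]

lemma vol_Z_le (hr : ∀ i, 0 < r i) {K : Set E3} {c : E3} (hout : ∀ x ∈ K, Qf b r (x - c) ≤ 27)
    {β : ℝ} {N : ℕ} (hN : 12 * r 0 < N * |β|) :
    volume (Zset b r K c) ≤ N * volume (Yset b r K c β) := by
  have hsub : Zset b r K c ⊆
      ⋃ k ∈ Finset.range N, (fun x => x + ((k:ℝ) * β) • b 0) ⁻¹' (Yset b r K c β) := by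
    intro z hz
    have hexit : ∃ k : ℕ, z + ((k:ℝ) * β) • b 0 ∉ K := by
      refine ⟨N, fun hmem => ?_⟩
      have h1 := abs0_le hr (hout _ hmem)
      have h2 := abs0_le hr (hout _ hz.1)
      have e : z + ((N:ℝ) * β) • b 0 - c = (z - c) + ((N:ℝ) * β) • b 0 := by abel
      rw [e, inner_add_left, real_inner_smul_left, aux_inner] at h1
      simp only [if_true, mul_one] at h1
      have h3 : |(N:ℝ) * β| ≤ 12 * r 0 := by
        have := abs_sub ((⟪z - c, b 0⟫:ℝ) + N * β) ⟪z - c, b 0⟫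
        rw [add_sub_cancel_left] at this
        linarith
      rw [abs_mul, abs_of_nonneg (Nat.cast_nonneg N)] at h3
      linarith
    classical
    have hspec := Nat.find_spec hexit
    have hpos : Nat.find hexit ≠ 0 := by
      intro h
      rw [h] at hspec
      apply hspec
      simpa using hz.1
    have hle : Nat.find hexit ≤ N := by
      apply Nat.find_min'
      intro hmem
      have h1 := abs0_le hr (hout _ hmem)
      have h2 := abs0_le hr (hout _ hz.1)
      have e : z + ((N:ℝ) * β) • b 0 - c = (z - c) + ((N:ℝ) * β) • b 0 := by abel
      rw [e, inner_add_left, real_inner_smul_left, aux_inner] at h1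
      simp only [if_true, mul_one] at h1
      have h3 : |(N:ℝ) * β| ≤ 12 * r 0 := by
        have := abs_sub ((⟪z - c, b 0⟫:ℝ) + N * β) ⟪z - c, b 0⟫
        rw [add_sub_cancel_left] at this
        linarith
      rw [abs_mul, abs_of_nonneg (Nat.cast_nonneg N)] at h3
      linarith
    obtain ⟨k, hk⟩ := Nat.exists_eq_succ_of_ne_zero hpos
    have hkK : z + ((k:ℝ) * β) • b 0 ∈ K := by
      have := Nat.find_min hexit (m := k) (by omega)
      simpa using this
    rw [hk] at hspec
    simp only [Set.mem_iUnion, Finset.mem_range]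
    refine ⟨k, by omega, ⟨hkK, ?_⟩, ?_⟩
    · have e : z + ((k:ℝ) * β) • b 0 - c = (z - c) + ((k:ℝ) * β) • b 0 := by abel
      rw [e, Qh_b0]; exact hz.2
    · convert hspec using 2
      push_cast
      module
  calc volume (Zset b r K c) ≤ _ := measure_mono hsub
    _ ≤ ∑ k ∈ Finset.range N,
        volume ((fun x => x + ((k:ℝ) * β) • b 0) ⁻¹' (Yset b r K c β)) :=
        measure_biUnion_finset_le _ _
    _ = N * volume (Yset b r K c β) := by
        simp [measure_preimage_add_right]

lemma vol_K_le {K : Set E3} {c : E3} (hin : ∀ v, Qf b r v ≤ 1 → c + v ∈ K)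
    (hout : ∀ x ∈ K, Qf b r (x - c) ≤ 27) :
    volume K ≤ 13824 * volume (Zset b r K c) := by
  have hsub : K ⊆ AffineMap.homothety c (24:ℝ) '' (Zset b r K c) := by
    intro x hx
    have h27 := hout x hx
    have hq : Qf b r ((1 / 24 : ℝ) • (x - c)) ≤ 1 / 16 := by
      rw [Qf_smul]; linarith
    refine ⟨c + (1 / 24 : ℝ) • (x - c), ⟨hin _ (by linarith), ?_⟩, ?_⟩
    · rw [add_sub_cancel_left]; exact (Qh_le_Qf b r _).trans hq
    · simp only [AffineMap.homothety_apply, vsub_eq_sub, vadd_eq_add]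
      module
  refine (measure_mono hsub).trans ?_
  rw [Measure.addHaar_image_homothety]
  have : Module.finrank ℝ E3 = 3 := by simp
  rw [this]
  norm_num

lemma cone_sub {K : Set E3} (hK : IsConvexBody K) (h0 : (0:E3) ∈ K) (ω : Set E3) :
    coneOver (gaussPre K ω) ⊆ K := by
  rintro _ ⟨x, hx, t, ht, rfl⟩
  have hxK : x ∈ K := hK.2.1.isClosed.frontier_subset hx.1
  exact hK.1.smul_mem_of_zero_mem h0 hxK ht

end Body

lemma measure_part {lam : ℝ} (hlam : 1 < lam) {f : E3 → ℝ} {K ω : Set E3}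
    (hf : ∀ u ∈ unitSphere, 1 / lam < f u ∧ f u < lam)
    (hK : IsConvexBody K) (h0 : (0:E3) ∈ K) (hS : SolvesLMP K f)
    (hω : ω ⊆ unitSphere) (hωm : MeasurableSet ω) {k A : ℕ}
    (hpack : (k : ℝ≥0∞) * μH[2] ω ≤ μH[2] unitSphere)
    (hvol : volume K ≤ A * volume (coneOver (gaussPre K ω))) :
    (k : ℝ) ≤ A * lam ^ 2 := by
  have hl0 : 0 < lam := by linarith
  have hVfin : volume K ≠ ∞ := hK.2.1.measure_lt_top.ne
  have hVpos : 0 < volume K :=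
    (isOpen_interior.measure_pos volume hK.2.2).trans_le (measure_mono interior_subset)
  have hSm : MeasurableSet unitSphere := (isCompact_sphere (0:E3) 1).measurableSet
  have hCfin : ∀ w, volume (coneOver (gaussPre K w)) ≠ ∞ := fun w =>
    ((measure_mono (cone_sub hK h0 w)).trans_lt hVfin.lt_top).ne
  have hmono : coneOver (gaussPre K ω) ⊆ coneOver (gaussPre K unitSphere) := by
    rintro _ ⟨x, ⟨hx, ν, hν, hn⟩, t, ht, rfl⟩
    exact ⟨x, ⟨hx, ν, hω hν, hn⟩, t, ht, rfl⟩
  have hCpos : 0 < volume (coneOver (gaussPre K ω)) := by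
    rcases eq_or_ne (volume (coneOver (gaussPre K ω))) 0 with h | h
    · rw [h, mul_zero] at hvol
      exact absurd hvol (not_le.mpr hVpos)
    · exact pos_iff_ne_zero.mpr h
  have eS := hS unitSphere subset_rfl hSm
  have eω := hS ω hω hωm
  have hCSpos : 0 < (volume (coneOver (gaussPre K unitSphere))).toReal :=
    ENNReal.toReal_pos (hCpos.trans_le (measure_mono hmono)).ne' (hCfin _)
  have hInt : IntegrableOn f unitSphere μH[2] := by
    by_contra hcon
    rw [integral_undef hcon] at eS
    linarith
  have hHfin : μH[2] unitSphere ≠ ∞ := by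
    have hi : IntegrableOn (fun _ : E3 => 1 / lam) unitSphere μH[2] := by
      refine Integrable.mono hInt aestronglyMeasurable_const ?_
      filter_upwards [ae_restrict_mem hSm] with u hu
      have := (hf u hu).1
      have hp : 0 < 1 / lam := by positivity
      rw [Real.norm_of_nonneg hp.le, Real.norm_of_nonneg (by linarith)]
      exact this.le
    have hne : (1 / lam : ℝ) ≠ 0 := by positivity
    rcases (integrableOn_const_iff (by simp)).mp hi with h | h
    · exact absurd h (by simpa using hl0.ne')
    · exact h.ne
  have hhfin : μH[2] ω ≠ ∞ := ((measure_mono hω).trans_lt hHfin.lt_top).ne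
  have l1 : (1 / lam) * (μH[2] unitSphere).toReal ≤ ∫ u in unitSphere, f u ∂(μH[2]) := by
    have := setIntegral_mono_on (μ := μH[2]) (f := fun _ : E3 => 1 / lam) (g := f)
      (integrableOn_const hHfin) hInt hSm (fun u hu => (hf u hu).1.le)
    rw [setIntegral_const, smul_eq_mul, mul_comm] at this
    exact this
  have l2 : ∫ u in ω, f u ∂(μH[2]) ≤ lam * (μH[2] ω).toReal := by
    have := setIntegral_mono_on (μ := μH[2]) (f := f) (g := fun _ : E3 => lam)
      (hInt.mono_set hω) (integrableOn_const hhfin) hωm (fun u hu => (hf u (hω hu)).2.le)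
    rw [setIntegral_const, smul_eq_mul, mul_comm] at this
    exact this
  have hCV : (volume (coneOver (gaussPre K unitSphere))).toReal ≤ (volume K).toReal :=
    ENNReal.toReal_mono hVfin (measure_mono (cone_sub hK h0 _))
  have hvol' : (volume K).toReal ≤ A * (volume (coneOver (gaussPre K ω))).toReal := by
    have := ENNReal.toReal_mono (ENNReal.mul_ne_top (ENNReal.natCast_ne_top A) (hCfin ω)) hvol
    rwa [ENNReal.toReal_mul, ENNReal.toReal_natCast] at this
  have hpack' : (k:ℝ) * (μH[2] ω).toReal ≤ (μH[2] unitSphere).toReal := by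
    have := ENNReal.toReal_mono hHfin hpack
    rwa [ENNReal.toReal_mul, ENNReal.toReal_natCast] at this
  have hcpos : 0 < (volume (coneOver (gaussPre K ω))).toReal :=
    ENNReal.toReal_pos hCpos.ne' (hCfin _)
  set h := (μH[2] ω).toReal
  set H := (μH[2] unitSphere).toReal
  have hhpos : 0 < h := by
    by_contra hcon
    push Not at hcon
    nlinarith
  have hA0 : (0:ℝ) ≤ A := Nat.cast_nonneg A
  have s1 : (1 / lam) * H ≤ A * (lam * h) := by nlinarith
  have s2 : H ≤ A * lam ^ 2 * h := by
    have := mul_le_mul_of_nonneg_left s1 hl0.le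
    rw [← mul_assoc, mul_one_div, div_self hl0.ne', one_mul] at this
    nlinarith
  have s3 : (k:ℝ) * h ≤ A * lam ^ 2 * h := hpack'.trans s2
  exact le_of_mul_le_mul_right s3 hhpos

set_option maxHeartbeats 1000000 in
theorem stmt8 (lam C₂ : ℝ) (hlam : 1 < lam) (hC₂ : 0 < C₂) :
    ∃ M₀ > 0, ∀ M ≥ M₀,
      ∀ (f : E3 → ℝ) (K E : Set E3) (c : E3) (e : Fin 3 → E3) (r : Fin 3 → ℝ),
      (∀ u ∈ unitSphere, 1 / lam < f u ∧ f u < lam) →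
      IsConvexBody K → 0 ∈ K → SolvesLMP K f →
      IsEllipsoid E c e r → c = centerOfMass K → IsJohnEllipsoid K E c →
      r 0 ≤ r 1 → r 1 ≤ r 2 →
      r 1 / r 0 > M → 1 / C₂ < r 2 / r 1 → r 2 / r 1 < C₂ →
      Metric.infDist (projPlane e 0) (intrinsicFrontier ℝ (projPlane e '' K)) ≤
        r 2 / (Real.sqrt M * C₂) := by
  set P : ℝ := 108 * (1 + 13824 * lam ^ 2 * (7200 * C₂ + 2)) + 1 with hP
  have hP1 : 109 ≤ P := by rw [hP]; nlinarith [show 0 ≤ lam ^ 2 * (7200 * C₂ + 2) by positivity]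
  refine ⟨P ^ 2, by positivity, ?_⟩
  intro M hM f K E c e r hf hK h0 hS hE _ hJ h01 h12 hMr _ hC2
  obtain ⟨hr, he, rfl⟩ := hE
  have hMpos : 0 < M := by nlinarith
  set m := Real.sqrt M with hm
  have hmP : P ≤ m := Real.le_sqrt_of_sq_le hM
  have hmM : m ^ 2 = M := Real.sq_sqrt hMpos.le
  have hr0 := hr 0
  have hr1 := hr 1
  have hr2 := hr 2
  have hC1 : 1 < C₂ := by
    refine lt_of_le_of_lt ?_ hC2
    rwa [one_le_div hr1]
  obtain ⟨b, hb⟩ : ∃ b : OrthonormalBasis (Fin 3) ℝ E3, ⇑b = e := by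
    refine ⟨OrthonormalBasis.mk he ?_, OrthonormalBasis.coe_mk he _⟩
    rw [he.linearIndependent.span_eq_top_of_card_eq_finrank
      (by rw [finrank_euclideanSpace])]
  subst hb
  have hQ : ∀ v, Qf b r v = ∑ i, (⟪v, b i⟫ / r i) ^ 2 := by
    intro v; simp [Qf, Qh, Fin.sum_univ_three, add_assoc]
  have hin : ∀ v, Qf b r v ≤ 1 → c + v ∈ K := by
    intro v hv
    apply hJ.1
    simp only [Set.mem_ofPred_eq, add_sub_cancel_left]
    rw [← hQ]; exact hv
  have hout : ∀ x ∈ K, Qf b r (x - c) ≤ 27 := by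
    intro x hx
    obtain ⟨z, hz, hzx⟩ := hJ.2 hx
    simp only [Set.mem_ofPred_eq] at hz
    rw [← hQ] at hz
    rw [← hzx]
    simp only [add_sub_cancel_left]
    rw [Qf_smul]
    have : ((3:ℝ) ^ ((3:ℝ) / 2)) ^ 2 = 27 := by
      rw [← Real.rpow_natCast, ← Real.rpow_mul (by norm_num)]; norm_num
    rw [this]; linarith
  by_contra hcon
  push Not at hcon
  have hp0 : projPlane b 0 = 0 := by simp [projPlane]
  rw [hp0] at hcon
  have hm0 : 0 < m := by linarith
  have hmC : 0 < m * C₂ := by positivity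
  set δ : ℝ := 1 / (6 * (m * C₂)) with hδ
  have hδ0 : 0 < δ := by positivity
  have hδ1 : δ ≤ 1 := by
    rw [hδ, div_le_one (by positivity)]
    nlinarith
  have hδr : δ * (6 * r 2) = r 2 / (m * C₂) := by rw [hδ]; field_simp
  obtain ⟨α, hα, hαK⟩ := chord hr h12 hK.1 h0 hin hout hδ0 hδ1 (by rw [hδr]; exact hcon)
  have ht : 12 * (r 0 / r 1) ≤ 12 / M := by
    have : r 0 / r 1 ≤ 1 / M := by
      rw [gt_iff_lt, lt_div_iff₀ hr0] at hMr
      rw [div_le_div_iff₀ hr1 hMpos]; linarith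
    calc _ ≤ 12 * (1 / M) := by linarith
      _ = _ := by ring
  have hsub := Y_sub_cone hr h12 hK h0 hin hout hαK ht
  set N : ℕ := ⌊7200 * (m * C₂)⌋₊ + 1 with hN
  have hN1 : 7200 * (m * C₂) < N := by
    rw [hN]; push_cast; exact Nat.lt_floor_add_one _
  have hN2 : (N:ℝ) ≤ 7200 * (m * C₂) + 1 := by
    rw [hN]; push_cast
    linarith [Nat.floor_le (show 0 ≤ 7200 * (m * C₂) by positivity)]
  have hNβ : 12 * r 0 < N * |α / 50| := by
    rw [abs_div, hα, abs_of_pos (by norm_num : (0:ℝ) < 50)]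
    have e : 12 * r 0 = 7200 * (m * C₂) * (δ * r 0 / 2 / 50) := by
      rw [hδ]; field_simp; norm_num
    rw [e]
    exact mul_lt_mul_of_pos_right hN1 (by positivity)
  have hv : volume K ≤ ((13824 * N : ℕ) : ℝ≥0∞) *
      volume (coneOver (gaussPre K (dcap b (12 / M)))) := by
    calc volume K ≤ 13824 * volume (Zset b r K c) := vol_K_le hin hout
      _ ≤ 13824 * (N * volume (Yset b r K c (α / 50))) := by
          gcongr; exact vol_Z_le hr hout hNβ
      _ ≤ 13824 * (N * volume (coneOver (gaussPre K (dcap b (12 / M))))) := by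
          gcongr
      _ = _ := by push_cast; ring
  have hM2 : 109 ^ 2 ≤ M := by nlinarith
  have hpk := packing b (12 / M) ⌊M / 108⌋₊ (by positivity)
    (by
      have : 12 / M ≤ 1 / 2 := by rw [div_le_div_iff₀ hMpos (by norm_num)]; linarith
      have h3 : 0 ≤ 12 / M := by positivity
      nlinarith)
    (by
      have := Nat.floor_le (show 0 ≤ M / 108 by positivity)
      calc (⌊M / 108⌋₊ : ℝ) * (9 * (12 / M)) ≤ M / 108 * (9 * (12 / M)) := by gcongr
        _ = 1 := by field_simp; norm_num)
  have hfin := measure_part hlam hf hK h0 hS (fun u hu => hu.1)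
    (dcap_compact b (12 / M)).measurableSet hpk hv
  push_cast at hfin
  have hfl := Nat.lt_floor_add_one (M / 108)
  have hl2 : 0 ≤ lam ^ 2 := sq_nonneg _
  have q1 : 13824 * (N:ℝ) * lam ^ 2 ≤ 13824 * lam ^ 2 * (7200 * (m * C₂) + 1) := by
    have := mul_le_mul_of_nonneg_left hN2 (show 0 ≤ 13824 * lam ^ 2 by positivity)
    linarith
  have q2 : m * P ≤ M := by
    rw [← hmM, sq]; exact mul_le_mul_of_nonneg_left hmP hm0.le
  have q3 : M / 108 < 1 + 13824 * lam ^ 2 * (7200 * (m * C₂) + 1) := by linarith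
  have q4 : m * P = 108 * (m + 13824 * lam ^ 2 * (7200 * (m * C₂) + 2 * m)) + m := by
    rw [hP]; ring
  have q5 : 13824 * lam ^ 2 * (7200 * (m * C₂) + 1) ≤
      13824 * lam ^ 2 * (7200 * (m * C₂) + 2 * m) := by
    apply mul_le_mul_of_nonneg_left _ (by positivity)
    linarith
  linarith
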